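/- arXiv:1210.2592 — 4 statements merged into one kernel-verified Lean document; each statement's English description precedes it below -/
import Mathlib

section
/- Let V and F be nonempty finite sets (variable nodes and factor nodes), and for each a ∈ F let ∂a ⊆ V be its (nonempty) neighborhood; for i ∈ V let ∂i = {a ∈ F : i ∈ ∂a}. Let X and Y be nonempty finite sets. For each a ∈ F let f̂_a : Y^{∂a} → ℝ, and for each edge (i,a) with i ∈ ∂a let φ_{i,a} : X × Y → ℝ. Define f_a : X^{∂a} → ℝ by f_a(x_{∂a}) = ∑_{y∈Y^{∂a}} f̂_a(y) ∏_{i∈∂a} φ_{i,a}(x_i, y_i). Then the partition function factorizes over edges: ∑_{x∈X^V} ∏_{a∈F} f_a(x_{∂a}) = ∑_{y∈Y^E} ∏_{a∈F} f̂_a(y_{∂a}) ∏_{i∈V} ( ∑_{x∈X} ∏_{a∈∂i} φ_{i,a}(x, y_{i,a}) ), where E = {(i,a) : a ∈ F, i ∈ ∂a} and y ∈ Y^E assigns an element of Y to each edge. -/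
/-- A product over the edges of a bipartite relation may be grouped by either endpoint. -/
theorem Fintype.prod_prod_subtype_comm {ι κ M : Type*} [Fintype ι] [Fintype κ] [CommMonoid M]
    (r : κ → ι → Prop) [∀ a, Fintype {i // r a i}] [∀ i, Fintype {a // r a i}]
    (g : ∀ a i, r a i → M) :
    ∏ a, ∏ i : {i // r a i}, g a i.1 i.2 = ∏ i, ∏ a : {a // r a i}, g a.1 i a.2 := by
  rw [← Fintype.prod_sigma', ← Fintype.prod_sigma']
  exact Fintype.prod_equiv
    ⟨fun p => ⟨p.2.1, p.1, p.2.2⟩, fun p => ⟨p.2.1, p.1, p.2.2⟩, fun _ => rfl, fun _ => rfl⟩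
    _ _ fun _ => rfl

/-- Edge-variable expansion of the partition function of a factor graph.
If each factor function factorizes through edge variables,
`f_a(x_{∂a}) = ∑_{y ∈ Y^{∂a}} f̂_a(y) ∏_{i∈∂a} φ_{i,a}(x_i, y_i)`, then
`∑_{x∈X^V} ∏_a f_a(x_{∂a})
  = ∑_{y∈Y^E} ∏_a f̂_a(y_{∂a}) ∏_{i∈V} (∑_{x∈X} ∏_{a∈∂i} φ_{i,a}(x, y_{i,a}))`. -/
theorem partition_function_edge_expansion
    {V F X Y : Type*} [Fintype V] [Fintype F] [Fintype X] [Fintype Y]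
    [Nonempty V] [Nonempty F] [Nonempty X] [Nonempty Y]
    [DecidableEq V] [DecidableEq F]
    (Nb : F → Finset V) (hNb : ∀ a, (Nb a).Nonempty)
    (fhat : (a : F) → ({i : V // i ∈ Nb a} → Y) → ℝ)
    (φ : V → F → X → Y → ℝ)
    (f : (a : F) → ({i : V // i ∈ Nb a} → X) → ℝ)
    (hf : ∀ (a : F) (ξ : {i : V // i ∈ Nb a} → X),
      f a ξ = ∑ y : {i : V // i ∈ Nb a} → Y,
        fhat a y * ∏ i : {i : V // i ∈ Nb a}, φ i.1 a (ξ i) (y i)) :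
    ∑ x : V → X, ∏ a : F, f a (fun i => x i.1)
      = ∑ y : (a : F) → {i : V // i ∈ Nb a} → Y,
          (∏ a : F, fhat a (y a)) *
            ∏ i : V, ∑ x : X,
              ∏ a : {a : F // i ∈ Nb a}, φ i a.1 x (y a.1 ⟨i, a.2⟩) := by
  simp_rw [hf, Fintype.prod_sum, Finset.prod_mul_distrib]
  rw [Finset.sum_comm]
  refine Finset.sum_congr rfl fun y _ => ?_
  rw [← Finset.mul_sum]
  congr 1
  exact Finset.sum_congr rfl fun x _ =>
    Fintype.prod_prod_subtype_comm (fun a i => i ∈ Nb a) fun a i h => φ i a (x i) (y a ⟨i, h⟩)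
end

section
/- Let V be a nonempty finite set and let F be a finite set of unordered pairs {i,j} of distinct elements of V, with coupling constants J : F → ℝ and inverse temperature β ∈ ℝ. Then the Ising partition function with zero magnetic field satisfies the high-temperature (even-subgraph) expansion: ∑_{x ∈ {+1,−1}^V} ∏_{{i,j}∈F} exp(β J_{i,j} x_i x_j) = 2^{|V|} ( ∏_{{i,j}∈F} cosh(β J_{i,j}) ) · ∑_{E' ⊆ F : every i ∈ V is incident to an even number of pairs in E'} ∏_{{i,j}∈E'} tanh(β J_{i,j}). -/
/-- The product `x_i x_j` of spins over an unordered pair `{i, j}`. -/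
noncomputable def spinPairProd {V : Type*} (x : V → ℝ) : Sym2 V → ℝ :=
  Sym2.lift ⟨fun i j => x i * x j, fun i j => by ring⟩

/-- The spin value `±1` associated with a Boolean. -/
noncomputable def spin (b : Bool) : ℝ := if b then 1 else -1

lemma spin_eq_one_or_neg_one (b : Bool) : spin b = 1 ∨ spin b = -1 := by
  cases b <;> simp [spin]

lemma spinPairProd_eq_one_or_neg_one {V : Type*} {x : V → ℝ} (hx : ∀ i, x i = 1 ∨ x i = -1)
    (e : Sym2 V) : spinPairProd x e = 1 ∨ spinPairProd x e = -1 := by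
  induction e with
  | _ i j =>
    rcases hx i with hi | hi <;> rcases hx j with hj | hj <;> simp [spinPairProd, hi, hj]

lemma exp_mul_eq_cosh_mul_one_add_tanh_mul (a : ℝ) {p : ℝ} (hp : p = 1 ∨ p = -1) :
    Real.exp (a * p) = Real.cosh a * (1 + Real.tanh a * p) := by
  have ha : Real.cosh a ≠ 0 := (Real.cosh_pos a).ne'
  rw [Real.tanh_eq_sinh_div_cosh]
  rcases hp with rfl | rfl
  · rw [mul_one, ← Real.cosh_add_sinh]
    field_simp
  · rw [mul_neg_one, ← Real.cosh_sub_sinh]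
    field_simp
    ring

lemma spinPairProd_eq_prod_ite {V : Type*} [Fintype V] [DecidableEq V] (x : V → ℝ)
    {e : Sym2 V} (he : ¬ e.IsDiag) :
    spinPairProd x e = ∏ i : V, if i ∈ e then x i else 1 := by
  induction e with
  | _ i j =>
    have hij : i ≠ j := by simpa using he
    have hfilter : (Finset.univ.filter fun k => k ∈ s(i, j)) = {i, j} := by
      ext k
      simp
    rw [← Finset.prod_filter, hfilter, Finset.prod_pair hij]
    rfl

lemma prod_spinPairProd_eq_prod_pow {V : Type*} [Fintype V] [DecidableEq V] (x : V → ℝ)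
    {E : Finset (Sym2 V)} (hE : ∀ e ∈ E, ¬ e.IsDiag) :
    ∏ e ∈ E, spinPairProd x e = ∏ i : V, x i ^ (E.filter (fun e => i ∈ e)).card := by
  rw [Finset.prod_congr rfl fun e he => spinPairProd_eq_prod_ite x (hE e he),
    Finset.prod_comm]
  refine Finset.prod_congr rfl fun i _ => ?_
  rw [← Finset.prod_filter, Finset.prod_const]

lemma sum_spin_pow (n : ℕ) : ∑ b : Bool, spin b ^ n = if Even n then 2 else 0 := by
  split_ifs with h
  · simp [spin, h.neg_one_pow, one_add_one_eq_two]
  · simp [spin, (Nat.not_even_iff_odd.mp h).neg_one_pow]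

lemma sum_prod_spinPairProd {V : Type*} [Fintype V] [DecidableEq V]
    {E : Finset (Sym2 V)} (hE : ∀ e ∈ E, ¬ e.IsDiag) :
    ∑ σ : V → Bool, ∏ e ∈ E, spinPairProd (fun i => spin (σ i)) e
      = if ∀ i : V, Even (E.filter (fun e => i ∈ e)).card then 2 ^ Fintype.card V else 0 := by
  simp_rw [prod_spinPairProd_eq_prod_pow _ hE]
  rw [← Fintype.prod_sum fun i b => spin b ^ (E.filter (fun e => i ∈ e)).card]
  simp_rw [sum_spin_pow]
  split_ifs with h
  · simp [h]
  · obtain ⟨i, hi⟩ := not_forall.mp h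
    exact Finset.prod_eq_zero (Finset.mem_univ i) (if_neg hi)

/-- High-temperature (even-subgraph) expansion of the zero-field Ising
partition function:
`∑_{x∈{±1}^V} ∏_{{i,j}∈F} exp(β J_{ij} x_i x_j)
  = 2^{|V|} (∏_{{i,j}∈F} cosh(β J_{ij})) ∑_{E'⊆F even} ∏_{{i,j}∈E'} tanh(β J_{ij})`,
where the sum runs over subsets `E' ⊆ F` in which every vertex is incident to an even
number of pairs. -/
theorem ising_high_temperature_expansion
    {V : Type*} [Fintype V] [Nonempty V] [DecidableEq V]
    (F : Finset (Sym2 V)) (hF : ∀ e ∈ F, ¬ e.IsDiag)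
    (J : Sym2 V → ℝ) (β : ℝ) :
    ∑ σ : V → Bool, ∏ e ∈ F, Real.exp (β * J e * spinPairProd (fun i => spin (σ i)) e)
      = 2 ^ (Fintype.card V) * (∏ e ∈ F, Real.cosh (β * J e)) *
          ∑ E' ∈ F.powerset.filter
              (fun E' => ∀ i : V, Even ((E'.filter (fun e => i ∈ e)).card)),
            ∏ e ∈ E', Real.tanh (β * J e) := by
  have expand (σ : V → Bool) :
      ∏ e ∈ F, Real.exp (β * J e * spinPairProd (fun i => spin (σ i)) e)
        = (∏ e ∈ F, Real.cosh (β * J e)) * ∑ E' ∈ F.powerset,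
            (∏ e ∈ E', Real.tanh (β * J e)) *
              ∏ e ∈ E', spinPairProd (fun i => spin (σ i)) e := by
    rw [Finset.prod_congr rfl fun e _ => exp_mul_eq_cosh_mul_one_add_tanh_mul (β * J e)
      (spinPairProd_eq_one_or_neg_one (fun i => spin_eq_one_or_neg_one (σ i)) e),
      Finset.prod_mul_distrib, Finset.prod_one_add]
    simp_rw [Finset.prod_mul_distrib]
  simp_rw [expand]
  rw [← Finset.mul_sum, Finset.sum_comm, mul_comm (2 ^ Fintype.card V), mul_assoc,
    Finset.sum_filter]
  congr 1
  rw [Finset.mul_sum]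
  refine Finset.sum_congr rfl fun E' hE' => ?_
  rw [← Finset.mul_sum,
    sum_prod_spinPairProd fun e he => hF e (Finset.mem_powerset.mp hE' he)]
  split_ifs <;> ring
end

section
/- Let β, J, l_i, l_j ∈ ℝ and define the probability mass function b on {+1,−1}² by b(x,y) = exp(βJ·x·y + l_i·x + l_j·y)/Z', where Z' = ∑_{x,y∈{+1,−1}} exp(βJ·x·y + l_i·x + l_j·y). Let (X,Y) ∼ b. Then the Pearson correlation coefficient Cor[X,Y] = Cov[X,Y]/(√Var[X]·√Var[Y]) equals sinh(2βJ) / ( √(cosh(2l_i) + cosh(2βJ)) · √(cosh(2l_j) + cosh(2βJ)) ). -/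
theorem sum_exp_add_mul_sum_exp_eq_cosh (K h k : ℝ) :
    (Real.exp (K + h + k) + Real.exp (-K + h - k)) *
        (Real.exp (-K - h + k) + Real.exp (K - h - k))
      = 2 * (Real.cosh (2 * k) + Real.cosh (2 * K)) := by
  simp only [Real.cosh_eq, add_mul, mul_add, ← Real.exp_add]
  ring_nf

theorem exp_mul_sub_exp_mul_eq_sinh (K h k : ℝ) :
    Real.exp (K + h + k) * Real.exp (K - h - k) -
        Real.exp (-K + h - k) * Real.exp (-K - h + k)
      = 2 * Real.sinh (2 * K) := by
  simp only [Real.sinh_eq, ← Real.exp_add]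
  ring_nf

/-- For the pairwise belief `b(x,y) ∝ exp(βJxy + l_i x + l_j y)` on
`{+1,−1}²`, the Pearson correlation coefficient of `(X, Y) ∼ b` equals
`sinh(2βJ) / (√(cosh(2l_i) + cosh(2βJ)) · √(cosh(2l_j) + cosh(2βJ)))`. -/
theorem ising_pairwise_belief_correlation
    (β J li lj : ℝ)
    (Z' : ℝ)
    (hZ' : Z' = ∑ x : Bool, ∑ y : Bool,
      Real.exp (β * J * spin x * spin y + li * spin x + lj * spin y))
    (b : Bool → Bool → ℝ)
    (hb : ∀ x y, b x y
      = Real.exp (β * J * spin x * spin y + li * spin x + lj * spin y) / Z')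
    (EX EY EXY EX2 EY2 : ℝ)
    (hEX : EX = ∑ x : Bool, ∑ y : Bool, b x y * spin x)
    (hEY : EY = ∑ x : Bool, ∑ y : Bool, b x y * spin y)
    (hEXY : EXY = ∑ x : Bool, ∑ y : Bool, b x y * (spin x * spin y))
    (hEX2 : EX2 = ∑ x : Bool, ∑ y : Bool, b x y * (spin x) ^ 2)
    (hEY2 : EY2 = ∑ x : Bool, ∑ y : Bool, b x y * (spin y) ^ 2) :
    (EXY - EX * EY) / (Real.sqrt (EX2 - EX ^ 2) * Real.sqrt (EY2 - EY ^ 2))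
      = Real.sinh (2 * β * J) /
          (Real.sqrt (Real.cosh (2 * li) + Real.cosh (2 * β * J)) *
            Real.sqrt (Real.cosh (2 * lj) + Real.cosh (2 * β * J))) := by
  have hrow := sum_exp_add_mul_sum_exp_eq_cosh (β * J) li lj
  have hcol := sum_exp_add_mul_sum_exp_eq_cosh (β * J) lj li
  have hdet := exp_mul_sub_exp_mul_eq_sinh (β * J) li lj
  rw [show β * J + lj + li = β * J + li + lj by ring,
    show -(β * J) + lj - li = -(β * J) - li + lj by ring,
    show -(β * J) - lj + li = -(β * J) + li - lj by ring,
    show β * J - lj - li = β * J - li - lj by ring] at hcol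
  have hpp : β * J * 1 * 1 + li * 1 + lj * 1 = β * J + li + lj := by ring
  have hpm : β * J * 1 * -1 + li * 1 + lj * -1 = -(β * J) + li - lj := by ring
  have hmp : β * J * -1 * 1 + li * -1 + lj * 1 = -(β * J) - li + lj := by ring
  have hmm : β * J * -1 * -1 + li * -1 + lj * -1 = β * J - li - lj := by ring
  simp only [hb, Fintype.sum_bool, spin, if_true, Bool.false_eq_true, if_false,
    hpp, hpm, hmp, hmm] at hZ' hEX hEY hEXY hEX2 hEY2
  rw [mul_assoc 2 β J]
  generalize 2 * (β * J) = t at *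
  have hp := Real.exp_pos (β * J + li + lj)
  have hq := Real.exp_pos (-(β * J) + li - lj)
  have hr := Real.exp_pos (-(β * J) - li + lj)
  have hs := Real.exp_pos (β * J - li - lj)
  generalize Real.exp (β * J + li + lj) = p at *
  generalize Real.exp (-(β * J) + li - lj) = q at *
  generalize Real.exp (-(β * J) - li + lj) = r at *
  generalize Real.exp (β * J - li - lj) = s at *
  have hZ : 0 < Z' := by rw [hZ']; positivity
  have hcov : EXY - EX * EY = 8 / Z' ^ 2 * Real.sinh t := by
    rw [hEXY, hEX, hEY]
    field_simp
    rw [hZ']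
    linear_combination 4 * hdet
  have hvarX : EX2 - EX ^ 2
      = 8 / Z' ^ 2 * (Real.cosh (2 * lj) + Real.cosh t) := by
    rw [hEX2, hEX]
    field_simp
    rw [hZ']
    linear_combination 4 * hrow
  have hvarY : EY2 - EY ^ 2
      = 8 / Z' ^ 2 * (Real.cosh (2 * li) + Real.cosh t) := by
    rw [hEY2, hEY]
    field_simp
    rw [hZ']
    linear_combination 4 * hcol
  have hc : 0 < 8 / Z' ^ 2 := by positivity
  rw [hcov, hvarX, hvarY, Real.sqrt_mul hc.le, Real.sqrt_mul hc.le, mul_mul_mul_comm,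
    Real.mul_self_sqrt hc.le, mul_div_mul_left _ _ hc.ne', mul_comm (Real.sqrt _)]
end

section
/- Let β, J ∈ ℝ and for l_i, l_j ∈ ℝ define C(l_i, l_j) = sinh(2βJ) / ( √(cosh(2l_i) + cosh(2βJ)) · √(cosh(2l_j) + cosh(2βJ)) ). Then |C(l_i, l_j)| ≤ |tanh(βJ)| for all l_i, l_j ∈ ℝ, and the maximum |tanh(βJ)| is attained at l_i = l_j = 0. -/
/-- The correlation `Cor_{b_a}[X_i, X_j]` of the pairwise Ising belief
`b_a(x,y) ∝ exp(βJxy + l_i x + l_j y)` on `{+1,−1}²`. -/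
noncomputable def isingCorrelation (β J li lj : ℝ) : ℝ :=
  Real.sinh (2 * β * J) /
    (Real.sqrt (Real.cosh (2 * li) + Real.cosh (2 * β * J)) *
      Real.sqrt (Real.cosh (2 * lj) + Real.cosh (2 * β * J)))

theorem isingCorrelation_zero_zero (β J : ℝ) :
    isingCorrelation β J 0 0 = Real.tanh (β * J) := by
  have hc := Real.cosh_pos (β * J)
  have hs := Real.cosh_sq (β * J)
  have hD : Real.cosh (2 * 0) + Real.cosh (2 * β * J) = 2 * Real.cosh (β * J) ^ 2 := by
    rw [mul_zero, Real.cosh_zero, mul_assoc, Real.cosh_two_mul]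
    linarith
  rw [isingCorrelation, hD, Real.mul_self_sqrt (by positivity), mul_assoc, Real.sinh_two_mul,
    Real.tanh_eq_sinh_div_cosh]
  field_simp

theorem abs_isingCorrelation_le_zero_zero (β J li lj : ℝ) :
    |isingCorrelation β J li lj| ≤ |isingCorrelation β J 0 0| := by
  have hpos : 0 < Real.cosh (2 * 0) + Real.cosh (2 * β * J) :=
    add_pos (Real.cosh_pos _) (Real.cosh_pos _)
  have hle (l : ℝ) : Real.sqrt (Real.cosh (2 * 0) + Real.cosh (2 * β * J)) ≤
      Real.sqrt (Real.cosh (2 * l) + Real.cosh (2 * β * J)) := by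
    apply Real.sqrt_le_sqrt
    rw [mul_zero, Real.cosh_zero]
    linarith [Real.one_le_cosh (2 * l)]
  have hsqrt := Real.sqrt_pos.mpr hpos
  simp only [isingCorrelation, abs_div, abs_mul, abs_of_nonneg (Real.sqrt_nonneg _)]
  exact div_le_div_of_nonneg_left (abs_nonneg _) (mul_pos hsqrt hsqrt)
    (mul_le_mul (hle li) (hle lj) hsqrt.le (Real.sqrt_nonneg _))

/-- `|C(l_i, l_j)| ≤ |tanh(βJ)|` for all `l_i, l_j`, and the maximum
`|tanh(βJ)|` is attained at `l_i = l_j = 0`. -/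
theorem ising_correlation_le_tanh (β J : ℝ) :
    (∀ li lj : ℝ, |isingCorrelation β J li lj| ≤ |Real.tanh (β * J)|) ∧
      |isingCorrelation β J 0 0| = |Real.tanh (β * J)| := by
  rw [← isingCorrelation_zero_zero]
  exact ⟨abs_isingCorrelation_le_zero_zero β J, rfl⟩
end
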